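/- Fix d ≥ 1. For all sufficiently large n the following holds. Let f(x) = Σ_{multisets S ⊆ [2n], |S| ≤ d} c_S ∏_{i∈S} x_i be a degree-d polynomial with weight(f) = 1 that passes the dictator test T_d with probability at least 1/2 + β, where β = 1/log n. For a ∈ {0,1}^n let f_a(g,h) denote the polynomial in (g_1,…,g_n,h_1,…,h_n) obtained as f evaluated at the point (a_1 h_1 + g_1^d, …, a_n h_n + g_n^d, g_1, …, g_n), and let ‖f_a‖_2 = (E_{g,h}[f_a(g,h)²])^{1/2} over i.i.d. standard Gaussians g_1,…,g_n,h_1,…,h_n. Then there exists a' ∈ {0,1}^n such that ‖f_{a'}‖_2 ≤ 2^{−n}·(log n)^{d²}. -/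

import Mathlib

open MeasureTheory ProbabilityTheory Real
open scoped ENNReal NNReal

/-- Evaluation of a polynomial given by its (finitely supported) coefficient
function on multisets of variable indices. -/
noncomputable def polyEval {ι : Type*} (c : Multiset ι →₀ ℝ) (x : ι → ℝ) : ℝ :=
  ∑ S ∈ c.support, c S * (S.map x).prod

/-- Bernoulli measure on `Bool` with `Pr[true] = p`. -/
noncomputable def bernoulliBool (p : ℝ) : Measure Bool :=
  ENNReal.ofReal p • Measure.dirac true + ENNReal.ofReal (1 - p) • Measure.dirac false

/-- Uniform measure on the signs `{-1, 1} ⊆ ℝ`. -/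
noncomputable def signUnif : Measure ℝ :=
  (2 : ℝ≥0∞)⁻¹ • Measure.dirac 1 + (2 : ℝ≥0∞)⁻¹ • Measure.dirac (-1)

/-- Product of `n` independent standard Gaussians. -/
noncomputable def stdGaussianPi (n : ℕ) : Measure (Fin n → ℝ) :=
  Measure.pi fun _ => gaussianReal 0 1

/-- The sample distribution of the dictator test `T_d`: `n` independent
Bernoulli(β) bits `a`, two vectors `h, g` of `n` i.i.d. standard Gaussians, and a
uniform random sign `b ∈ {-1, 1}`, where `β = 1 / log n`. -/
noncomputable def TdMeasure (n : ℕ) :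
    Measure ((Fin n → Bool) × (Fin n → ℝ) × (Fin n → ℝ) × ℝ) :=
  (Measure.pi fun _ : Fin n => bernoulliBool (1 / Real.log n)).prod
    ((stdGaussianPi n).prod ((stdGaussianPi n).prod signUnif))

/-- The query point `y ∈ ℝ^{2n}` of the dictator test `T_d`: coordinates are
indexed by `Fin n ⊕ Fin n` (`Sum.inl i` is coordinate `i`, `Sum.inr i` is
coordinate `n + i`), with `y_i = a_i h_i + g_i ^ d + b δ` and `y_{n+i} = g_i`,
where `δ = 2 ^ (-n²)`. -/
noncomputable def TdPoint (d n : ℕ)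
    (ω : (Fin n → Bool) × (Fin n → ℝ) × (Fin n → ℝ) × ℝ) : Fin n ⊕ Fin n → ℝ :=
  Sum.elim
    (fun i => (if ω.1 i then ω.2.1 i else 0) + (ω.2.2.1 i) ^ d
      + ω.2.2.2 * (2 : ℝ) ^ (-((n : ℤ) ^ 2)))
    fun i => ω.2.2.1 i

/-- `weight(f) = Σ_{S ≠ ∅} |c_S|`: the total coefficient weight of the
nonconstant monomials. -/
noncomputable def weight {ι : Type*} [DecidableEq ι] (c : Multiset ι →₀ ℝ) : ℝ :=
  ∑ S ∈ c.support, if S = 0 then 0 else |c S|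


lemma coef_bound_one (μ : Measure ℝ) (s R : ℝ) (hs : 0 < s) (hR : 0 ≤ R)
    (hμ : ∀ x, μ (Set.Ioo (x - s) (x + s)) ≤ ENNReal.ofReal (2 * s)) :
    ∀ (D : ℕ) (E : Set ℝ), E ⊆ Set.Icc (-R) R → (D : ℝ≥0∞) * ENNReal.ofReal (2 * s) < μ E →
      ∀ p : Polynomial ℝ, p.natDegree ≤ D → ∀ η : ℝ, 0 ≤ η → (∀ x ∈ E, |p.eval x| ≤ η) →
      ∀ k, |p.coeff k| ≤ η * (2 / s * (1 + R) + 1) ^ D := by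
  intro D
  induction D with
  | zero =>
    intro E hE hpos p hp η hη hb k
    have hne : E.Nonempty := by
      by_contra h
      rw [Set.not_nonempty_iff_eq_empty] at h
      simp [h] at hpos
    obtain ⟨y, hy⟩ := hne
    have h1 := hb y hy
    rw [Polynomial.eq_C_of_natDegree_le_zero hp] at h1 ⊢
    simp only [Polynomial.eval_C] at h1
    rw [Polynomial.coeff_C]
    split_ifs
    · simpa using h1
    · simpa using hη
  | succ D ih =>
    intro E hE hpos p hp η hη hb k
    have hne : E.Nonempty := by
      by_contra h
      rw [Set.not_nonempty_iff_eq_empty] at h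
      simp [h] at hpos
    obtain ⟨y, hy⟩ := hne
    have hyR : |y| ≤ R := abs_le.mpr (hE hy)
    set q := p /ₘ (Polynomial.X - Polynomial.C y) with hq
    have hpq : p = Polynomial.C (p.eval y) + (Polynomial.X - Polynomial.C y) * q := by
      conv_lhs => rw [← Polynomial.modByMonic_add_div p (Polynomial.X - Polynomial.C y)]
      rw [Polynomial.modByMonic_X_sub_C_eq_C_eval]
    have hqd : q.natDegree ≤ D := by
      rw [hq, Polynomial.natDegree_divByMonic _ (Polynomial.monic_X_sub_C y),
        Polynomial.natDegree_X_sub_C]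
      omega
    have hE' : (D : ℝ≥0∞) * ENNReal.ofReal (2 * s) < μ (E \ Set.Ioo (y - s) (y + s)) := by
      by_contra hcon
      push Not at hcon
      have : μ E ≤ ((D + 1 : ℕ) : ℝ≥0∞) * ENNReal.ofReal (2 * s) := by
        calc μ E ≤ μ ((E \ Set.Ioo (y - s) (y + s)) ∪ Set.Ioo (y - s) (y + s)) := by
              apply measure_mono
              rw [Set.sdiff_union_self]
              exact Set.subset_union_left
          _ ≤ μ (E \ Set.Ioo (y - s) (y + s)) + μ (Set.Ioo (y - s) (y + s)) :=
              measure_union_le _ _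
          _ ≤ (D : ℝ≥0∞) * ENNReal.ofReal (2 * s) + ENNReal.ofReal (2 * s) :=
              add_le_add hcon (hμ y)
          _ = _ := by push_cast; ring
      exact absurd hpos (not_lt.mpr this)
    have hqb : ∀ x ∈ E \ Set.Ioo (y - s) (y + s), |q.eval x| ≤ 2 / s * η := by
      intro x hx
      have hd : s ≤ |x - y| := by
        by_contra h
        push Not at h
        rw [abs_lt] at h
        exact hx.2 ⟨by linarith, by linarith⟩
      have hev : p.eval x = p.eval y + (x - y) * q.eval x := by
        conv_lhs => rw [hpq]
        simp
      have h1 := hb x hx.1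
      have h2 := hb y hy
      have h3 : |x - y| * |q.eval x| ≤ 2 * η := by
        rw [← abs_mul, show (x - y) * q.eval x = p.eval x - p.eval y by rw [hev]; ring]
        calc _ ≤ |p.eval x| + |p.eval y| := abs_sub _ _
          _ ≤ _ := by linarith
      have h4 : s * |q.eval x| ≤ 2 * η := le_trans (by gcongr) h3
      rw [div_mul_eq_mul_div, le_div_iff₀ hs]
      linarith
    have hco := ih _ (Set.sdiff_subset.trans hE) hE' q hqd (2 / s * η) (by positivity) hqb
    set B := 2 / s * (1 + R) + 1 with hB
    have hB1 : 1 ≤ B ^ D := one_le_pow₀ (by rw [hB]; have : 0 ≤ 2 / s * (1 + R) := by positivity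
                                            linarith)
    set A := 2 / s * η * B ^ D with hA
    have hA0 : 0 ≤ A := by positivity
    have hey := hb y hy
    have key : |p.coeff k| ≤ η + A + R * A := by
      rw [hpq, sub_mul, Polynomial.coeff_add, Polynomial.coeff_sub, Polynomial.coeff_C_mul]
      have e1 : |(Polynomial.C (p.eval y)).coeff k| ≤ η := by
        rw [Polynomial.coeff_C]; split_ifs
        · exact hey
        · simpa using hη
      have e2 : |(Polynomial.X * q).coeff k| ≤ A := by
        cases k with
        | zero => simpa using hA0
        | succ k => rw [Polynomial.coeff_X_mul]; exact hco k
      have e3 : |y * q.coeff k| ≤ R * A := by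
        rw [abs_mul]; exact mul_le_mul hyR (hco k) (abs_nonneg _) hR
      calc _ ≤ _ := abs_add_le _ _
        _ ≤ η + (A + R * A) := add_le_add e1 ((abs_sub _ _).trans (add_le_add e2 e3))
        _ = _ := by ring
    calc _ ≤ _ := key
      _ ≤ η * B ^ D + A + R * A := by
          have := mul_le_mul_of_nonneg_left hB1 hη
          linarith
      _ = _ := by rw [hA, pow_succ, hB]; ring

lemma multi_small_ball (μ : Measure ℝ) [IsProbabilityMeasure μ] (D : ℕ) (L : ℝ) (hL : 0 ≤ L)
    (r : ℝ≥0∞)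
    (H : ∀ p : Polynomial ℝ, p.natDegree ≤ D → ∀ η : ℝ, 0 ≤ η → ∀ k, η * L < |p.coeff k| →
      μ {x | |p.eval x| ≤ η} ≤ r) :
    ∀ (m : ℕ) (p : MvPolynomial (Fin m) ℝ), (∀ i, p.degreeOf i ≤ D) → ∀ η : ℝ, 0 ≤ η →
      ∀ e, η * L ^ m < |p.coeff e| →
      Measure.pi (fun _ : Fin m => μ) {x | |MvPolynomial.eval x p| ≤ η} ≤ m * r := by
  intro m
  induction m with
  | zero =>
    intro p hp η hη e he
    have : {x : Fin 0 → ℝ | |MvPolynomial.eval x p| ≤ η} = ∅ := by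
      ext x
      simp only [Set.mem_ofPred_eq, Set.mem_empty_iff_false, iff_false, not_le]
      rw [MvPolynomial.eq_C_of_isEmpty p] at he ⊢
      rw [MvPolynomial.eval_C]
      have : e = 0 := Subsingleton.elim _ _
      subst this
      simpa using he
    simp [this]
  | succ m ih =>
    intro p hp η hη e he
    set P := MvPolynomial.finSuccEquiv ℝ m p with hP
    set q := P.coeff (e 0) with hqdef
    have hq : q.coeff (Finsupp.tail e) = p.coeff e := by
      rw [hqdef, hP, MvPolynomial.finSuccEquiv_coeff_coeff, Finsupp.cons_tail]
    have hqdeg : ∀ i, q.degreeOf i ≤ D := fun i =>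
      (MvPolynomial.degreeOf_coeff_finSuccEquiv p i (e 0)).trans (hp _)
    have hA := ih q hqdeg (η * L) (by positivity) (Finsupp.tail e) (by
      rw [hq]; rw [pow_succ'] at he; rwa [mul_assoc])
    set A := {x : Fin m → ℝ | |MvPolynomial.eval x q| ≤ η * L} with hAdef
    have hAm : MeasurableSet A := by
      apply measurableSet_le _ measurable_const
      exact (MvPolynomial.continuous_eval q).measurable.abs
    have hSm : MeasurableSet {x : Fin (m+1) → ℝ | |MvPolynomial.eval x p| ≤ η} := by
      apply measurableSet_le _ measurable_const
      exact (MvPolynomial.continuous_eval p).measurable.abs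
    have mp := (measurePreserving_piFinSuccAbove (fun _ : Fin (m+1) => μ) 0).symm
    rw [← mp.measure_preimage hSm.nullMeasurableSet]
    rw [Measure.prod_apply_symm (mp.measurable hSm)]
    calc _ ≤ ∫⁻ s, (A.indicator 1 s + r) ∂(Measure.pi (fun _ : Fin m => μ)) := by
          apply lintegral_mono
          intro s
          by_cases hs : s ∈ A
          · simp only [Set.indicator_of_mem hs, Pi.one_apply]
            exact prob_le_one.trans le_self_add
          · simp only [Set.indicator_of_notMem hs, zero_add]
            have hs' : η * L < |(P.map (MvPolynomial.eval s)).coeff (e 0)| := by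
              rw [Polynomial.coeff_map]
              simpa [hAdef] using hs
            refine le_trans (le_of_eq ?_) (H (P.map (MvPolynomial.eval s)) ?_ η hη (e 0) hs')
            · congr 1
              ext y
              simp only [Set.mem_preimage, Set.mem_ofPred_eq]
              rw [hP, ← MvPolynomial.eval_eq_eval_mv_eval']
              have hcons : (MeasurableEquiv.piFinSuccAbove (fun _ : Fin (m+1) => ℝ) 0).symm (y, s)
                  = (Fin.cons y s : Fin (m+1) → ℝ) := by
                funext i
                refine Fin.cases ?_ (fun j => ?_) i
                · simp [MeasurableEquiv.piFinSuccAbove]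
                · simp [MeasurableEquiv.piFinSuccAbove]
              rw [hcons]
            · refine (Polynomial.natDegree_map_le).trans ?_
              rw [hP, MvPolynomial.natDegree_finSuccEquiv]
              exact hp 0
      _ = Measure.pi (fun _ : Fin m => μ) A + r := by
          rw [lintegral_add_right _ measurable_const, lintegral_indicator_one hAm]
          simp
      _ ≤ m * r + r := by gcongr
      _ = _ := by push_cast; ring

lemma gauss_Ioo (x s : ℝ) (hs : 0 < s) :
    gaussianReal 0 1 (Set.Ioo (x - s) (x + s)) ≤ ENNReal.ofReal (2 * s) := by
  rw [gaussianReal_apply 0 one_ne_zero]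
  calc _ ≤ ∫⁻ _ in Set.Ioo (x - s) (x + s), 1 := by
        apply lintegral_mono
        intro y
        rw [gaussianPDF_def]
        apply ENNReal.ofReal_le_one.mpr
        rw [gaussianPDFReal_def]
        have h1 : (√(2 * π * ((1:ℝ≥0):ℝ)))⁻¹ ≤ 1 := by
          apply inv_le_one_of_one_le₀
          rw [Real.one_le_sqrt]
          have := Real.pi_gt_three
          simp; linarith
        have h2 : rexp (-(y - 0) ^ 2 / (2 * ((1:ℝ≥0):ℝ))) ≤ 1 := by
          rw [Real.exp_le_one_iff]
          have := sq_nonneg (y - 0)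
          simp only [NNReal.coe_one]
          linarith
        exact mul_le_one₀ h1 (Real.exp_nonneg _) h2
    _ = _ := by
        rw [setLIntegral_const, one_mul, Real.volume_Ioo]
        congr 1; ring

lemma gauss_tail (R : ℝ) (hR : 0 < R) :
    gaussianReal 0 1 (Set.Icc (-R) R)ᶜ ≤ ENNReal.ofReal (1 / R ^ 2) := by
  have h := meas_ge_le_variance_div_sq (μ := gaussianReal 0 1) (X := id)
    (memLp_id_gaussianReal 2) hR
  rw [variance_id_gaussianReal] at h
  refine le_trans (measure_mono ?_) (h.trans (by simp))
  intro x hx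
  simp only [Set.mem_ofPred_eq, id]
  have : ∫ x, id x ∂(gaussianReal 0 1) = 0 := by simp
  simp only [id] at this
  rw [this, sub_zero]
  by_contra hlt
  push Not at hlt
  exact hx ⟨(abs_lt.mp hlt).1.le, (abs_lt.mp hlt).2.le⟩

lemma l2_bound (D : ℕ) : ∃ K : ℝ, 1 ≤ K ∧ ∀ (m : ℕ) (p : MvPolynomial (Fin m) ℝ) (A : ℝ),
    (∀ i, p.degreeOf i ≤ D) → (∀ e, |p.coeff e| ≤ A) →
    ∫ x, (MvPolynomial.eval x p) ^ 2 ∂(Measure.pi (fun _ : Fin m => gaussianReal 0 1))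
      ≤ (A * K ^ m) ^ 2 := by
  set μ := gaussianReal 0 1 with hμ
  set K0 : ℝ := ∑ k ∈ Finset.range (D + 1), ∫ x, (x ^ k) ^ 2 ∂μ with hK0
  have hnn : ∀ k : ℕ, 0 ≤ ∫ x, (x ^ k) ^ 2 ∂μ := fun k => integral_nonneg (fun x => by positivity)
  have hint : ∀ k : ℕ, Integrable (fun x : ℝ => (x ^ k) ^ 2) μ := by
    intro k
    have h : MemLp id ((2 * k : ℕ) : ℝ≥0∞) (gaussianReal 0 1) :=
      memLp_id_gaussianReal' _ (ENNReal.natCast_ne_top _)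
    have h2 := h.integrable_norm_pow'
    refine h2.congr (Filter.Eventually.of_forall fun x => ?_)
    simp only [id, Real.norm_eq_abs]
    rw [pow_mul, sq_abs, ← pow_mul, ← pow_mul, mul_comm]
  have hK1 : 1 ≤ K0 := by
    calc (1:ℝ) = ∫ x, (x ^ 0) ^ 2 ∂μ := by simp
      _ ≤ K0 := Finset.single_le_sum (f := fun k : ℕ => ∫ x, (x ^ k) ^ 2 ∂μ)
        (fun k _ => hnn k) (by simp)
  have hKk : ∀ k ≤ D, ∫ x, (x ^ k) ^ 2 ∂μ ≤ K0 := fun k hk =>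
    Finset.single_le_sum (f := fun k : ℕ => ∫ x, (x ^ k) ^ 2 ∂μ)
        (fun k _ => hnn k) (by simp; omega)
  refine ⟨(D + 1) * K0, ?_, ?_⟩
  · have : (1:ℝ) ≤ D + 1 := by simp
    nlinarith
  intro m p A hdeg hA
  have hA0 : 0 ≤ A := (abs_nonneg _).trans (hA 0)
  set π' := Measure.pi (fun _ : Fin m => μ) with hπ
  have hsd : ∀ e ∈ p.support, ∀ i, e i ≤ D := fun e he i =>
    (MvPolynomial.monomial_le_degreeOf i he).trans (hdeg i)
  have hcard : (p.support.card : ℝ) ≤ ((D:ℝ) + 1) ^ m := by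
    have : p.support.card ≤ (Fintype.piFinset (fun _ : Fin m => Finset.range (D+1))).card := by
      apply Finset.card_le_card_of_injOn (fun e : Fin m →₀ ℕ => (e : Fin m → ℕ))
      · intro e he
        simp only [Finset.mem_coe, Fintype.mem_piFinset, Finset.mem_range]
        intro i
        have := hsd e he i
        omega
      · exact DFunLike.coe_injective.injOn
    rw [Fintype.card_piFinset_const, Finset.card_range] at this
    exact_mod_cast this
  have hmi : ∀ e : Fin m →₀ ℕ, Integrable (fun x : Fin m → ℝ => ∏ i, (x i ^ e i) ^ 2) π' := by
    intro e
    exact Integrable.fintype_prod (f := fun i (y:ℝ) => (y ^ e i) ^ 2) (fun i => hint (e i))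
  have hmb : ∀ e ∈ p.support, ∫ x, ∏ i, (x i ^ e i) ^ 2 ∂π' ≤ K0 ^ m := by
    intro e he
    rw [hπ, integral_fintype_prod_eq_prod (𝕜 := ℝ) (fun i (y:ℝ) => (y ^ e i) ^ 2)]
    calc _ ≤ ∏ i : Fin m, K0 := Finset.prod_le_prod (fun i _ => hnn _)
            (fun i _ => hKk _ (hsd e he i))
      _ = _ := by simp
  have hpt : ∀ x : Fin m → ℝ, (MvPolynomial.eval x p) ^ 2 ≤
      p.support.card * ∑ e ∈ p.support, A ^ 2 * ∏ i, (x i ^ e i) ^ 2 := by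
    intro x
    rw [MvPolynomial.eval_eq']
    refine sq_sum_le_card_mul_sum_sq.trans ?_
    gcongr with e he
    rw [mul_pow, ← Finset.prod_pow]
    refine mul_le_mul_of_nonneg_right ?_ (Finset.prod_nonneg (fun i _ => sq_nonneg _))
    · exact sq_le_sq' (abs_le.mp (hA e)).1 (abs_le.mp (hA e)).2
  calc _ ≤ ∫ x, p.support.card * ∑ e ∈ p.support, A ^ 2 * ∏ i, (x i ^ e i) ^ 2 ∂π' := by
        apply integral_mono_of_nonneg
        · exact Filter.Eventually.of_forall (fun x => sq_nonneg _)
        · exact (integrable_finsetSum _ (fun e _ => (hmi e).const_mul _)).const_mul _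
        · exact Filter.Eventually.of_forall hpt
    _ = p.support.card * ∑ e ∈ p.support, A ^ 2 * ∫ x, ∏ i, (x i ^ e i) ^ 2 ∂π' := by
        rw [integral_const_mul, integral_finsetSum _ (fun e _ => (hmi e).const_mul _)]
        simp only [integral_const_mul]
    _ ≤ p.support.card * ∑ e ∈ p.support, A ^ 2 * K0 ^ m := by
        gcongr with e he
        exact hmb e he
    _ = (p.support.card : ℝ) ^ 2 * A ^ 2 * K0 ^ m := by simp; ring
    _ ≤ (((D:ℝ) + 1) ^ m) ^ 2 * A ^ 2 * (K0 ^ m) ^ 2 := by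
        gcongr
        have : 1 ≤ K0 ^ m := one_le_pow₀ hK1
        nlinarith
    _ = _ := by rw [mul_pow ((D:ℝ)+1)]; ring

lemma mp_split (μ : Measure ℝ) [IsProbabilityMeasure μ] (n : ℕ) :
    MeasurePreserving (fun x : Fin (n + n) → ℝ =>
      ((fun i => x (Fin.castAdd n i) : Fin n → ℝ), (fun i => x (Fin.natAdd n i) : Fin n → ℝ)))
      (Measure.pi (fun _ => μ))
      ((Measure.pi (fun _ : Fin n => μ)).prod (Measure.pi (fun _ : Fin n => μ))) := by
  have h1 := (measurePreserving_piCongrLeft (fun _ : Fin (n+n) => μ) (finSumFinEquiv (m := n) (n := n))).symm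
  have h2 := measurePreserving_sumPiEquivProdPi (fun _ : Fin n ⊕ Fin n => μ)
  have h3 := h2.comp h1
  exact h3

lemma prod_abs_bound {ι : Type*} (S : Multiset ι) (x : ι → ℝ) (Y : ℝ) (hY : 0 ≤ Y)
    (hx : ∀ i, |x i| ≤ Y) : |(S.map x).prod| ≤ Y ^ (Multiset.card S) := by
  induction S using Multiset.induction_on with
  | empty => simp
  | cons a S ih =>
    rw [Multiset.map_cons, Multiset.prod_cons, abs_mul, Multiset.card_cons, pow_succ']
    exact mul_le_mul (hx a) ih (abs_nonneg _) hY

lemma prod_diff {ι : Type*} (S : Multiset ι) (x x' : ι → ℝ) (Y δ : ℝ) (hY : 1 ≤ Y) (hδ : 0 ≤ δ)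
    (hx : ∀ i, |x i| ≤ Y) (hx' : ∀ i, |x' i| ≤ Y) (hd : ∀ i, |x i - x' i| ≤ δ) :
    |(S.map x).prod - (S.map x').prod| ≤ Multiset.card S * Y ^ (Multiset.card S) * δ := by
  have hY0 : 0 ≤ Y := by linarith
  induction S using Multiset.induction_on with
  | empty => simp
  | cons a S ih =>
    simp only [Multiset.map_cons, Multiset.prod_cons, Multiset.card_cons]
    set p := (S.map x).prod
    set p' := (S.map x').prod
    set k := Multiset.card S
    have e : x a * p - x' a * p' = x a * (p - p') + (x a - x' a) * p' := by ring
    have hp' : |p'| ≤ Y ^ k := prod_abs_bound S x' Y hY0 hx'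
    rw [e]
    calc _ ≤ |x a * (p - p')| + |(x a - x' a) * p'| := abs_add_le _ _
      _ ≤ Y * (k * Y ^ k * δ) + δ * Y ^ k := by
          rw [abs_mul, abs_mul]
          exact add_le_add (mul_le_mul (hx a) ih (abs_nonneg _) hY0)
            (mul_le_mul (hd a) hp' (abs_nonneg _) hδ)
      _ ≤ Y * (k * Y ^ k * δ) + δ * Y ^ (k + 1) := by
          gcongr
          omega
      _ = _ := by push_cast; ring

lemma polyEval_diff {ι : Type*} [DecidableEq ι] (c : Multiset ι →₀ ℝ) (d : ℕ)
    (hc : ∀ S ∈ c.support, Multiset.card S ≤ d) (hw : weight c = 1)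
    (x x' : ι → ℝ) (Y δ : ℝ) (hY : 1 ≤ Y) (hδ : 0 ≤ δ)
    (hx : ∀ i, |x i| ≤ Y) (hx' : ∀ i, |x' i| ≤ Y) (hd : ∀ i, |x i - x' i| ≤ δ) :
    |polyEval c x - polyEval c x'| ≤ d * Y ^ d * δ := by
  have hY0 : 0 ≤ Y := by linarith
  unfold polyEval
  rw [← Finset.sum_sub_distrib]
  calc _ ≤ ∑ S ∈ c.support, |c S * (S.map x).prod - c S * (S.map x').prod| :=
        Finset.abs_sum_le_sum_abs _ _
    _ ≤ ∑ S ∈ c.support, (if S = 0 then 0 else |c S|) * (d * Y ^ d * δ) := by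
        apply Finset.sum_le_sum
        intro S hS
        split_ifs with h
        · simp [h]
        · rw [← mul_sub, abs_mul]
          have hk := hc S hS
          refine mul_le_mul_of_nonneg_left ?_ (abs_nonneg _)
          refine (prod_diff S x x' Y δ hY hδ hx hx' hd).trans ?_
          gcongr
    _ = weight c * (d * Y ^ d * δ) := by rw [weight, Finset.sum_mul]
    _ = _ := by rw [hw, one_mul]

lemma fa_poly (d n : ℕ) (hd : 1 ≤ d) (c : Multiset (Fin n ⊕ Fin n) →₀ ℝ)
    (hc : ∀ S ∈ c.support, Multiset.card S ≤ d) (a : Fin n → Bool) :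
    ∃ P : MvPolynomial (Fin (n + n)) ℝ, (∀ i, P.degreeOf i ≤ d * d) ∧
      ∀ x, MvPolynomial.eval x P = polyEval c (Sum.elim
        (fun i => (if a i then x (Fin.natAdd n i) else 0) + (x (Fin.castAdd n i)) ^ d)
        fun i => x (Fin.castAdd n i)) := by
  let X' : Fin n ⊕ Fin n → MvPolynomial (Fin (n + n)) ℝ := Sum.elim
    (fun i => (if a i then MvPolynomial.X (Fin.natAdd n i) else 0)
      + (MvPolynomial.X (Fin.castAdd n i)) ^ d)
    fun i => MvPolynomial.X (Fin.castAdd n i)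
  have hX' : ∀ j, (X' j).totalDegree ≤ d := by
    rintro (i | i)
    · refine (MvPolynomial.totalDegree_add _ _).trans (max_le ?_ ?_)
      · split_ifs
        · rw [MvPolynomial.totalDegree_X]; exact hd
        · simp
      · refine (MvPolynomial.totalDegree_pow _ _).trans ?_
        rw [MvPolynomial.totalDegree_X, mul_one]
    · simp only [X', Sum.elim_inr]
      rw [MvPolynomial.totalDegree_X]; exact hd
  refine ⟨∑ S ∈ c.support, MvPolynomial.C (c S) * (S.map X').prod, ?_, ?_⟩
  · intro i
    refine (MvPolynomial.degreeOf_le_totalDegree _ _).trans ?_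
    apply MvPolynomial.totalDegree_finsetSum_le
    intro S hS
    refine (MvPolynomial.totalDegree_mul _ _).trans ?_
    rw [MvPolynomial.totalDegree_C, zero_add]
    refine (MvPolynomial.totalDegree_multiset_prod _).trans ?_
    refine (Multiset.sum_le_card_nsmul _ d ?_).trans ?_
    · intro t ht
      simp only [Multiset.map_map, Multiset.mem_map, Function.comp] at ht
      obtain ⟨j, _, rfl⟩ := ht
      exact hX' j
    · simp only [Multiset.card_map, smul_eq_mul]
      exact Nat.mul_le_mul_right _ (hc S hS)
  · intro x
    rw [map_sum, polyEval]
    apply Finset.sum_congr rfl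
    intro S _
    rw [map_mul, MvPolynomial.eval_C, map_multiset_prod, Multiset.map_map]
    congr 3
    funext j
    rcases j with i | i
    · simp only [X', Function.comp, Sum.elim_inl, map_add, map_pow, MvPolynomial.eval_X]
      split_ifs <;> simp
    · simp [X']

lemma continuous_polyEval {ι : Type*} (c : Multiset ι →₀ ℝ) : Continuous (polyEval c) := by
  unfold polyEval
  refine continuous_finsetSum _ (fun S _ => continuous_const.mul ?_)
  exact continuous_multiset_prod S (fun i _ => continuous_apply i)

instance : IsProbabilityMeasure signUnif := by
  constructor
  simp [signUnif, ENNReal.inv_two_add_inv_two]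

lemma bern_prob (p : ℝ) (h0 : 0 ≤ p) (h1 : p ≤ 1) : IsProbabilityMeasure (bernoulliBool p) := by
  constructor
  simp [bernoulliBool]
  rw [← ENNReal.ofReal_add h0 (by linarith)]
  simp

instance (n : ℕ) : IsProbabilityMeasure (stdGaussianPi n) := by
  unfold stdGaussianPi; infer_instance

lemma measurable_TdPoint (d n : ℕ) : Measurable (TdPoint d n) := by
  rw [measurable_pi_iff]
  rintro (i | i)
  · simp only [TdPoint, Sum.elim_inl]
    refine Measurable.add (Measurable.add ?_ ?_) ?_
    · refine Measurable.ite ?_ ?_ measurable_const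
      · exact measurableSet_eq_fun (by fun_prop) measurable_const
      · fun_prop
    · fun_prop
    · fun_prop
  · simp only [TdPoint, Sum.elim_inr]
    fun_prop

lemma measurable_pass (d n : ℕ) (c : Multiset (Fin n ⊕ Fin n) →₀ ℝ) :
    MeasurableSet {ω : (Fin n → Bool) × (Fin n → ℝ) × (Fin n → ℝ) × ℝ |
      Real.sign (polyEval c (TdPoint d n ω)) = ω.2.2.2} := by
  have hs : Measurable Real.sign := by
    unfold Real.sign
    refine Measurable.ite measurableSet_Iio measurable_const ?_
    exact Measurable.ite measurableSet_Ioi measurable_const measurable_const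
  refine measurableSet_eq_fun ?_ (by fun_prop)
  exact hs.comp ((continuous_polyEval c).measurable.comp (measurable_TdPoint d n))

lemma sign_slice (F : ℝ → ℝ) (F0 η : ℝ) (h : ∀ b, b = 1 ∨ b = -1 → |F b - F0| ≤ η)
    (hF : η < |F0|) (hm : MeasurableSet {b | Real.sign (F b) = b}) :
    signUnif {b | Real.sign (F b) = b} ≤ 2⁻¹ := by
  have h1 := abs_le.mp (h 1 (Or.inl rfl))
  have h2 := abs_le.mp (h (-1) (Or.inr rfl))
  simp only [signUnif, Measure.add_apply, Measure.smul_apply, smul_eq_mul]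
  rw [Measure.dirac_apply' _ hm, Measure.dirac_apply' _ hm]
  rcases lt_abs.mp hF with hp | hn
  · have : (-1 : ℝ) ∉ {b | Real.sign (F b) = b} := by
      simp only [Set.mem_ofPred_eq]
      rw [Real.sign_of_pos (by linarith)]; norm_num
    rw [Set.indicator_of_notMem this, mul_zero, add_zero]
    refine mul_le_of_le_one_right' ?_
    exact Set.indicator_le_self' (by simp) _
  · have : (1 : ℝ) ∉ {b | Real.sign (F b) = b} := by
      simp only [Set.mem_ofPred_eq]
      rw [Real.sign_of_neg (by linarith)]; norm_num
    rw [Set.indicator_of_notMem this, mul_zero, zero_add]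
    refine mul_le_of_le_one_right' ?_
    exact Set.indicator_le_self' (by simp) _

lemma gauss_one_var (D : ℕ) (s R : ℝ) (hs : 0 < s) (hR : 0 < R) (p : Polynomial ℝ)
    (hp : p.natDegree ≤ D) (η : ℝ) (hη : 0 ≤ η) (k : ℕ)
    (hk : η * (2 / s * (1 + R) + 1) ^ D < |p.coeff k|) :
    gaussianReal 0 1 {x | |p.eval x| ≤ η} ≤
      (D : ℝ≥0∞) * ENNReal.ofReal (2 * s) + ENNReal.ofReal (1 / R ^ 2) := by
  by_contra hcon
  push Not at hcon
  set E := {x | |p.eval x| ≤ η} with hE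
  have h1 : gaussianReal 0 1 E ≤ gaussianReal 0 1 (E ∩ Set.Icc (-R) R)
      + ENNReal.ofReal (1 / R ^ 2) := by
    refine le_trans ?_ (add_le_add le_rfl (gauss_tail R hR))
    refine le_trans (measure_mono ?_) (measure_union_le _ _)
    intro x hx
    by_cases hxR : x ∈ Set.Icc (-R) R
    · exact Or.inl ⟨hx, hxR⟩
    · exact Or.inr hxR
  have h2 : (D : ℝ≥0∞) * ENNReal.ofReal (2 * s) < gaussianReal 0 1 (E ∩ Set.Icc (-R) R) :=
    lt_of_add_lt_add_right (hcon.trans_le h1)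
  have h3 := coef_bound_one (gaussianReal 0 1) s R hs hR.le (fun x => gauss_Ioo x s hs) D _
    Set.inter_subset_right h2 p hp η hη (fun x hx => hx.1) k
  linarith

lemma mp_full (n : ℕ) : MeasurePreserving
    (fun z : (Fin (n + n) → ℝ) × ℝ =>
      ((fun i => z.1 (Fin.natAdd n i) : Fin n → ℝ),
        (fun i => z.1 (Fin.castAdd n i) : Fin n → ℝ), z.2))
    ((Measure.pi (fun _ => gaussianReal 0 1)).prod signUnif)
    ((stdGaussianPi n).prod ((stdGaussianPi n).prod signUnif)) := by
  have h1 := mp_split (gaussianReal 0 1) n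
  have h2 := (Measure.measurePreserving_swap (μ := stdGaussianPi n) (ν := stdGaussianPi n)).comp h1
  have h3 := h2.prod (MeasurePreserving.id signUnif)
  have h4 := (measurePreserving_prodAssoc (stdGaussianPi n) (stdGaussianPi n) signUnif).comp h3
  exact h4

lemma box_compl (m : ℕ) (R : ℝ) (hR : 0 < R) :
    Measure.pi (fun _ : Fin m => gaussianReal 0 1) (⋃ j, {x | x j ∉ Set.Icc (-R) R}) ≤
      m * ENNReal.ofReal (1 / R ^ 2) := by
  refine (measure_iUnion_fintype_le _ _).trans ?_
  calc _ ≤ ∑ _j : Fin m, ENNReal.ofReal (1 / R ^ 2) := by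
        apply Finset.sum_le_sum
        intro j _
        have h := (measurePreserving_eval (fun _ : Fin m => gaussianReal 0 1) j).measure_preimage
          (measurableSet_Icc (a := -R) (b := R)).compl.nullMeasurableSet
        exact (le_of_eq h).trans (gauss_tail R hR)
    _ = _ := by simp

/-- The core bound: all coefficients of the restricted polynomial are tiny. -/
lemma core (d n : ℕ) (c : Multiset (Fin n ⊕ Fin n) →₀ ℝ)
    (hc : ∀ S ∈ c.support, Multiset.card S ≤ d) (hw : weight c = 1) (a : Fin n → Bool)
    (β : ℝ) (s R δ Y η : ℝ) (hs : 0 < s) (hR : 0 < R)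
    (hδ : δ = (2 : ℝ) ^ (-((n : ℤ) ^ 2)))
    (hY : Y = R + R ^ d + 1) (hη : η = d * Y ^ d * δ)
    (hβ : ((n + n : ℕ) : ℝ≥0∞) * (((d * d : ℕ) : ℝ≥0∞) * ENNReal.ofReal (2 * s)
      + ENNReal.ofReal (1 / R ^ 2)) + ((n + n : ℕ) : ℝ≥0∞) * ENNReal.ofReal (1 / R ^ 2)
      < ENNReal.ofReal (2 * β))
    (hpass : ENNReal.ofReal (1 / 2 + β) ≤ ((stdGaussianPi n).prod ((stdGaussianPi n).prod signUnif))
      {ω | Real.sign (polyEval c (TdPoint d n (a, ω))) = ω.2.2})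
    (P : MvPolynomial (Fin (n + n)) ℝ) (hPd : ∀ i, P.degreeOf i ≤ d * d)
    (hPe : ∀ x, MvPolynomial.eval x P = polyEval c (Sum.elim
        (fun i => (if a i then x (Fin.natAdd n i) else 0) + (x (Fin.castAdd n i)) ^ d)
        fun i => x (Fin.castAdd n i))) (e : Fin (n + n) →₀ ℕ) :
    |P.coeff e| ≤ η * ((2 / s * (1 + R) + 1) ^ (d * d)) ^ (n + n) := by
  have hδ0 : 0 < δ := by rw [hδ]; positivity
  have hδ1 : δ ≤ 1 := by
    rw [hδ]
    apply zpow_le_one_of_nonpos₀ (by norm_num)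
    have := sq_nonneg (n : ℤ)
    linarith
  have hY1 : 1 ≤ Y := by rw [hY]; have := pow_pos hR d; linarith
  have hη0 : 0 ≤ η := by rw [hη]; positivity
  by_contra hcon
  push Not at hcon
  set π' := Measure.pi (fun _ : Fin (n + n) => gaussianReal 0 1) with hπ
  have hsmall := multi_small_ball (gaussianReal 0 1) (d * d) ((2 / s * (1 + R) + 1) ^ (d * d))
    (by positivity) _ (fun p hp η hη k hk => gauss_one_var (d * d) s R hs hR p hp η hη k hk)
    (n + n) P hPd η hη0 e hcon
  have hbox := box_compl (n + n) R hR
  rw [← hπ] at hsmall hbox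
  set G1 : Set (Fin (n + n) → ℝ) := {x | |MvPolynomial.eval x P| ≤ η} with hG1
  set G2 : Set (Fin (n + n) → ℝ) := ⋃ j, {x | x j ∉ Set.Icc (-R) R} with hG2
  have hG1m : MeasurableSet G1 := by
    apply measurableSet_le _ measurable_const
    exact (MvPolynomial.continuous_eval P).measurable.abs
  have hG2m : MeasurableSet G2 := by
    apply MeasurableSet.iUnion
    intro j
    have hj : Measurable (fun x : Fin (n + n) → ℝ => x j) := measurable_pi_apply j
    exact hj (measurableSet_Icc (a := -R) (b := R)).compl
  have hGlt : π' (G1 ∪ G2) < ENNReal.ofReal (2 * β) :=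
    ((measure_union_le _ _).trans (add_le_add hsmall hbox)).trans_lt hβ
  have hSm : MeasurableSet {ω : (Fin n → ℝ) × (Fin n → ℝ) × ℝ |
      Real.sign (polyEval c (TdPoint d n (a, ω))) = ω.2.2} :=
    measurable_prodMk_left (measurable_pass d n c)
  rw [← (mp_full n).measure_preimage hSm.nullMeasurableSet,
    Measure.prod_apply ((mp_full n).measurable hSm)] at hpass
  have hub : ENNReal.ofReal (1 / 2 + β) ≤ 2⁻¹ + 2⁻¹ * π' (G1 ∪ G2) := by
    refine hpass.trans ?_
    calc _ ≤ ∫⁻ x, (2⁻¹ + 2⁻¹ * (G1 ∪ G2).indicator 1 x) ∂π' := by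
          apply lintegral_mono
          intro x
          by_cases hx : x ∈ G1 ∪ G2
          · simp only [Set.indicator_of_mem hx, Pi.one_apply, mul_one,
              ENNReal.inv_two_add_inv_two]
            exact prob_le_one
          · simp only [Set.indicator_of_notMem hx, mul_zero, add_zero]
            simp only [Set.mem_union, not_or] at hx
            obtain ⟨hx1, hx2⟩ := hx
            have hxR : ∀ j, |x j| ≤ R := by
              intro j
              by_contra hj
              apply hx2
              rw [hG2, Set.mem_iUnion]
              exact ⟨j, fun hI => hj (abs_le.mpr hI)⟩
            have hx1' : η < |MvPolynomial.eval x P| := by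
              simpa [hG1] using hx1
            have hmslice := measurable_prodMk_left (x := x) ((mp_full n).measurable hSm)
            refine sign_slice (fun b => polyEval c (TdPoint d n
              (a, (fun i => x (Fin.natAdd n i)), (fun i => x (Fin.castAdd n i)), b)))
              (MvPolynomial.eval x P) η ?_ hx1' hmslice
            intro b hb
            have hb1 : |b| = 1 := by rcases hb with rfl | rfl <;> simp
            rw [hPe, hη]
            have hbase : ∀ i : Fin n, |(if a i then x (Fin.natAdd n i) else 0)
                + (x (Fin.castAdd n i)) ^ d| ≤ R + R ^ d := by
              intro i
              refine (abs_add_le _ _).trans (add_le_add ?_ ?_)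
              · split_ifs
                · exact hxR _
                · simpa using hR.le
              · rw [abs_pow]
                exact pow_le_pow_left₀ (abs_nonneg _) (hxR _) d
            have hRY : R ≤ Y := by rw [hY]; have := pow_pos hR d; linarith
            apply polyEval_diff c d hc hw _ _ Y δ hY1 hδ0.le
            · rintro (i | i)
              · simp only [TdPoint, Sum.elim_inl]
                refine (abs_add_le _ _).trans ?_
                rw [hY]
                refine add_le_add (hbase i) ?_
                rw [abs_mul, hb1, one_mul, ← hδ, abs_of_pos hδ0]
                exact hδ1
              · simp only [TdPoint, Sum.elim_inr]
                exact (hxR _).trans hRY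
            · rintro (i | i)
              · simp only [Sum.elim_inl]
                refine (hbase i).trans ?_
                rw [hY]; linarith
              · simp only [Sum.elim_inr]
                exact (hxR _).trans hRY
            · rintro (i | i)
              · simp only [TdPoint, Sum.elim_inl]
                rw [add_sub_cancel_left, abs_mul, hb1, one_mul, ← hδ, abs_of_pos hδ0]
              · simp only [TdPoint, Sum.elim_inr, sub_self, abs_zero]
                exact hδ0.le
      _ = 2⁻¹ + 2⁻¹ * π' (G1 ∪ G2) := by
          rw [lintegral_add_left measurable_const, lintegral_const_mul _
            (measurable_one.indicator (hG1m.union hG2m)),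
            lintegral_indicator_one (hG1m.union hG2m)]
          simp
  have hlt : 2⁻¹ + 2⁻¹ * π' (G1 ∪ G2) < ENNReal.ofReal (1 / 2 + β) := by
    have hβpos : 0 < 2 * β := by
      by_contra h
      push Not at h
      rw [ENNReal.ofReal_of_nonpos h] at hGlt
      exact absurd hGlt (by simp)
    have h12 : (2⁻¹ : ℝ≥0∞) = ENNReal.ofReal (1 / 2) := by
      rw [one_div, ENNReal.ofReal_inv_of_pos (by norm_num)]; simp
    have e1 : ENNReal.ofReal (1 / 2 + β) = 2⁻¹ + 2⁻¹ * ENNReal.ofReal (2 * β) := by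
      rw [h12, ← ENNReal.ofReal_mul (by norm_num), ← ENNReal.ofReal_add (by norm_num) (by linarith)]
      congr 1; ring
    rw [e1]
    apply ENNReal.add_lt_add_left (by simp)
    exact ENNReal.mul_lt_mul_right (by simp) (by simp) hGlt
  exact absurd hub (not_le.mpr hlt)

lemma numeric (d : ℕ) (K : ℝ) : ∃ N : ℕ, ∀ n ≥ N, 
    (3 ≤ n) ∧ K ≤ n ∧ d ≤ n ∧ 4 * (d * d) + 4 < n ∧
    (n : ℝ) ^ (1 + (3 * d + 1) * d + 14 * (d * d) + 2) ≤ 2 ^ n / 2 := by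
  set C := 1 + (3 * d + 1) * d + 14 * (d * d) + 2
  have h := tendsto_pow_const_div_const_pow_of_one_lt C (r := (2:ℝ)) (by norm_num)
  have h1 := h.eventually (gt_mem_nhds (show (0:ℝ) < 1 / 2 by norm_num))
  have h2 := (h1.and (Filter.eventually_ge_atTop (3 + ⌈K⌉₊ + d + (4 * (d * d) + 5))))
  obtain ⟨N, hN⟩ := Filter.eventually_atTop.mp h2
  refine ⟨N, fun n hn => ?_⟩
  obtain ⟨ha, hb⟩ := hN n hn
  refine ⟨by omega, ?_, by omega, by omega, ?_⟩
  · refine (Nat.le_ceil K).trans ?_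
    exact_mod_cast (by omega : ⌈K⌉₊ ≤ n)
  · rw [div_lt_iff₀ (by positivity)] at ha
    linarith

lemma final_num (d n : ℕ) (hd : 1 ≤ d) (K : ℝ) (hK1 : 1 ≤ K) (hn3 : 3 ≤ n) (hK : K ≤ n) (hdn : d ≤ n)
    (hbig : (n : ℝ) ^ (1 + (3 * d + 1) * d + 14 * (d * d) + 2) ≤ 2 ^ n / 2) :
    (d * ((n:ℝ) ^ 3 + ((n:ℝ) ^ 3) ^ d + 1) ^ d * (2 : ℝ) ^ (-((n : ℤ) ^ 2))) *
      ((2 / (1 / (n:ℝ) ^ 3) * (1 + (n:ℝ) ^ 3) + 1) ^ (d * d)) ^ (n + n) * K ^ (n + n) ≤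
      2 ^ (-(n : ℤ)) := by
  have hx : (3:ℝ) ≤ n := by exact_mod_cast hn3
  have hx1 : (1:ℝ) ≤ n := by linarith
  set x : ℝ := (n : ℝ) with hxdef
  have hY : x ^ 3 + (x ^ 3) ^ d + 1 ≤ x ^ (3 * d + 1) := by
    have e1 : x ^ 3 ≤ x ^ (3 * d) := pow_le_pow_right₀ hx1 (by omega)
    have e2 : 1 ≤ x ^ (3 * d) := one_le_pow₀ hx1
    rw [← pow_mul, pow_succ x (3 * d)]
    nlinarith
  have hL : 2 / (1 / x ^ 3) * (1 + x ^ 3) + 1 ≤ x ^ 7 := by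
    have e : 2 / (1 / x ^ 3) = 2 * x ^ 3 := by field_simp
    rw [e]
    have e3 : 27 ≤ x ^ 3 := by
      calc (27:ℝ) = 3 ^ 3 := by norm_num
        _ ≤ _ := pow_le_pow_left₀ (by norm_num) hx 3
    have e7 : x ^ 7 = x * (x ^ 3 * x ^ 3) := by ring
    rw [e7]
    nlinarith [mul_nonneg (sub_nonneg.mpr hx) (mul_nonneg (by linarith : 0 ≤ x ^ 3) (by linarith : 0 ≤ x ^ 3))]
  have hdx : (d:ℝ) ≤ x := by rw [hxdef]; exact_mod_cast hdn
  have hL0 : 0 ≤ 2 / (1 / x ^ 3) * (1 + x ^ 3) + 1 := by positivity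
  have hδ : (2:ℝ) ^ (-((n : ℤ) ^ 2)) = ((2 ^ n) ^ n)⁻¹ := by
    rw [zpow_neg, ← pow_mul, ← sq]; norm_cast
  have h2n : (2:ℝ) ^ (-(n:ℤ)) = (2 ^ n)⁻¹ := by rw [zpow_neg]; norm_cast
  rw [hδ, h2n]
  calc _ ≤ (x * (x ^ (3 * d + 1)) ^ d * ((2 ^ n) ^ n)⁻¹) * ((x ^ 7) ^ (d * d)) ^ (n + n)
        * x ^ (n + n) := by
        gcongr
    _ = x ^ (1 + (3 * d + 1) * d) * x ^ ((14 * (d * d) + 2) * n) * ((2 ^ n) ^ n)⁻¹ := by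
        simp only [← pow_mul, pow_add, pow_one]; ring
    _ ≤ x ^ ((1 + (3 * d + 1) * d) * n) * x ^ ((14 * (d * d) + 2) * n) * ((2 ^ n) ^ n)⁻¹ := by
        gcongr
        · exact Nat.le_mul_of_pos_right _ (by omega)
    _ = (x ^ (1 + (3 * d + 1) * d + 14 * (d * d) + 2)) ^ n * ((2 ^ n) ^ n)⁻¹ := by
        rw [← pow_add, ← pow_mul]; ring_nf
    _ ≤ (2 ^ n / 2) ^ n * ((2 ^ n) ^ n)⁻¹ := by gcongr
    _ = _ := by
        rw [div_pow]; field_simp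

lemma beta_num (d n : ℕ) (hn3 : 3 ≤ n) (h : 4 * (d * d) + 4 < n) :
    ((n + n : ℕ) : ℝ≥0∞) * (((d * d : ℕ) : ℝ≥0∞) * ENNReal.ofReal (2 * (1 / (n:ℝ) ^ 3))
      + ENNReal.ofReal (1 / ((n:ℝ) ^ 3) ^ 2)) + ((n + n : ℕ) : ℝ≥0∞) *
        ENNReal.ofReal (1 / ((n:ℝ) ^ 3) ^ 2)
      < ENNReal.ofReal (2 * (1 / Real.log n)) := by
  have hx : (3:ℝ) ≤ n := by exact_mod_cast hn3
  have hh : 4 * ((d:ℝ) * d) + 4 < n := by exact_mod_cast h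
  set x : ℝ := (n : ℝ) with hxdef
  have hx0 : 0 < x := by linarith
  have hlog : 0 < Real.log x := Real.log_pos (by linarith)
  have hll : Real.log x ≤ x := Real.log_le_self hx0.le
  rw [← ENNReal.ofReal_natCast, ← ENNReal.ofReal_natCast, ← ENNReal.ofReal_mul (by positivity),
    ← ENNReal.ofReal_add (by positivity) (by positivity), ← ENNReal.ofReal_mul (by positivity),
    ← ENNReal.ofReal_mul (by positivity), ← ENNReal.ofReal_add (by positivity) (by positivity)]
  rw [ENNReal.ofReal_lt_ofReal_iff (by positivity)]
  have h1 : 2 * (1 / x) ≤ 2 * (1 / Real.log x) := by gcongr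
  refine lt_of_lt_of_le ?_ h1
  push_cast
  rw [← hxdef]
  have e : (x + x) * ((d:ℝ) * d * (2 * (1 / x ^ 3)) + 1 / (x ^ 3) ^ 2) + (x + x) * (1 / (x ^ 3) ^ 2)
    = (4 * ((d:ℝ) * d) * x ^ 3 + 4) / x ^ 5 := by field_simp; ring
  have e' : 2 * (1 / x) = 2 * x ^ 4 / x ^ 5 := by field_simp
  rw [e, e']
  apply div_lt_div_of_pos_right _ (by positivity)
  have hx3 : 1 ≤ x ^ 3 := one_le_pow₀ (by linarith)
  have : (4 * ((d:ℝ) * d) + 4) * x ^ 3 < x * x ^ 3 := by gcongr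
  nlinarith

/-- Claim 3.3: if a degree-`d` polynomial `f` of weight `1` passes the dictator
test `T_d` with probability at least `1/2 + β` (`β = 1/log n`), then some
restriction `f_{a'}` (the polynomial in `(g, h)` obtained by evaluating `f` at
`(a_1 h_1 + g_1^d, …, a_n h_n + g_n^d, g_1, …, g_n)`) has Gaussian `L²` norm at
most `2^{-n} (log n)^{d²}`, for all sufficiently large `n`. -/
theorem stmt1 (d : ℕ) (hd : 1 ≤ d) :
    ∃ N : ℕ, ∀ n ≥ N, ∀ c : Multiset (Fin n ⊕ Fin n) →₀ ℝ,
      (∀ S ∈ c.support, Multiset.card S ≤ d) →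
      weight c = 1 →
      ENNReal.ofReal (1 / 2 + 1 / Real.log n) ≤
        TdMeasure n {ω | Real.sign (polyEval c (TdPoint d n ω)) = ω.2.2.2} →
      ∃ a : Fin n → Bool,
        Real.sqrt (∫ gh : (Fin n → ℝ) × (Fin n → ℝ),
            (polyEval c (Sum.elim
              (fun i => (if a i then gh.2 i else 0) + (gh.1 i) ^ d)
              fun i => gh.1 i)) ^ 2
          ∂((stdGaussianPi n).prod (stdGaussianPi n))) ≤
        2 ^ (-(n : ℤ)) * Real.log n ^ (d ^ 2) := by

  obtain ⟨K, hK1, hK⟩ := l2_bound (d * d)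
  obtain ⟨N, hN⟩ := numeric d K
  refine ⟨N, fun n hn c hc hw hpass => ?_⟩
  obtain ⟨hn3, hKn, hdn, h4, hbig⟩ := hN n hn
  have hx : (3:ℝ) ≤ n := by exact_mod_cast hn3
  have hlog1 : 1 ≤ Real.log n := by
    rw [Real.le_log_iff_exp_le (by linarith)]
    have := Real.exp_one_lt_d9
    linarith
  have : IsProbabilityMeasure (bernoulliBool (1 / Real.log n)) :=
    bern_prob _ (by positivity) (by rw [div_le_one (by linarith)]; exact hlog1)
  rw [TdMeasure, Measure.prod_apply (measurable_pass d n c)] at hpass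
  obtain ⟨a, ha⟩ := exists_lintegral_le
    (μ := Measure.pi fun _ : Fin n => bernoulliBool (1 / Real.log n))
    (f := fun a => ((stdGaussianPi n).prod ((stdGaussianPi n).prod signUnif))
      (Prod.mk a ⁻¹' {ω : (Fin n → Bool) × (Fin n → ℝ) × (Fin n → ℝ) × ℝ |
        Real.sign (polyEval c (TdPoint d n ω)) = ω.2.2.2}))
    (by
      refine ne_top_of_le_ne_top ENNReal.one_ne_top ?_
      calc _ ≤ ∫⁻ _a : Fin n → Bool, 1
              ∂(Measure.pi fun _ : Fin n => bernoulliBool (1 / Real.log n)) :=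
            lintegral_mono (fun a => prob_le_one)
        _ = 1 := by rw [lintegral_one]; exact measure_univ)
  refine ⟨a, ?_⟩
  obtain ⟨P, hPd, hPe⟩ := fa_poly d n hd c hc a
  have hco := core d n c hc hw a (1 / Real.log n) (1 / (n:ℝ) ^ 3) ((n:ℝ) ^ 3) _ _ _
    (by positivity) (by positivity) rfl rfl rfl (beta_num d n hn3 h4) (hpass.trans ha) P hPd hPe
  have hint := hK (n + n) P _ hPd hco
  have heq : ∫ gh : (Fin n → ℝ) × (Fin n → ℝ),
            (polyEval c (Sum.elim
              (fun i => (if a i then gh.2 i else 0) + (gh.1 i) ^ d)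
              fun i => gh.1 i)) ^ 2
          ∂((stdGaussianPi n).prod (stdGaussianPi n))
      = ∫ x, (MvPolynomial.eval x P) ^ 2
          ∂(Measure.pi (fun _ : Fin (n + n) => gaussianReal 0 1)) := by
    have hmp := mp_split (gaussianReal 0 1) n
    have hcont : Continuous (fun gh : (Fin n → ℝ) × (Fin n → ℝ) =>
        (polyEval c (Sum.elim
              (fun i => (if a i then gh.2 i else 0) + (gh.1 i) ^ d)
              fun i => gh.1 i)) ^ 2) := by
      refine ((continuous_polyEval c).comp ?_).pow 2
      rw [continuous_pi_iff]
      rintro (i | i)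
      · simp only [Sum.elim_inl]
        split_ifs <;> fun_prop
      · simp only [Sum.elim_inr]
        fun_prop
    rw [stdGaussianPi, ← hmp.map_eq,
      integral_map hmp.measurable.aemeasurable hcont.aestronglyMeasurable]
    simp only [hPe]
  rw [heq]
  refine (Real.sqrt_le_sqrt hint).trans ?_
  rw [Real.sqrt_sq (by positivity)]
  refine (final_num d n hd K hK1 hn3 hKn hdn hbig).trans ?_
  exact le_mul_of_one_le_right (by positivity) (one_le_pow₀ hlog1)
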